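/- Let q : [0,1] → ℝ be continuous, nonpositive (q(x) ≤ 0 on [0,1]) and increasing on [0,1], and set q₋ = min{q(x) : x ∈ [0,1]}. Let λ₁ < λ₂ < ⋯ denote the eigenvalues of the Dirichlet–Neumann problem −y'' + q(x) y = λ y on [0,1] with y(0) = y'(1) = 0. If for two different indices n ≠ m with λ_n > λ_m ≥ −2q₋ equality λ_n / λ_m = (2n−1)² / (2m−1)² holds, then q ≡ 0 on (0,1]. -/

import Mathlib

/-- `lam` is an eigenvalue of the Dirichlet–Neumann problem `−y'' + q y = λ y` on
`[0,1]`, `y 0 = 0`, `y' 1 = 0`: there is a nontrivial solution (with derivative `y'`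
and `y'' = (q − λ) y` on `[0,1]`) satisfying the boundary conditions. -/
def IsDirichletNeumannEigenvalue (q : ℝ → ℝ) (lam : ℝ) : Prop :=
  ∃ y y' : ℝ → ℝ,
    (∀ x ∈ Set.Icc (0 : ℝ) 1, HasDerivAt y (y' x) x) ∧
    (∀ x ∈ Set.Icc (0 : ℝ) 1, HasDerivAt y' ((q x - lam) * y x) x) ∧
    (∃ x ∈ Set.Icc (0 : ℝ) 1, y x ≠ 0) ∧
    y 0 = 0 ∧ y' 1 = 0

section

open Set Filter Topology Real

/-- On an interval where `c - p` and `Y * Y'` have opposite signs, the energy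
`Y' ^ 2 + (z ^ 2 + c) * Y ^ 2` does not increase. -/
lemma energy_le {p Y Y' : ℝ → ℝ} {z a b c : ℝ} (hab : a ≤ b)
    (hY : ∀ x ∈ Icc a b, HasDerivAt Y (Y' x) x)
    (hY' : ∀ x ∈ Icc a b, HasDerivAt Y' (-(z ^ 2 + p x) * Y x) x)
    (hsign : ∀ x ∈ Icc a b, (c - p x) * (Y x * Y' x) ≤ 0) :
    Y' b ^ 2 + (z ^ 2 + c) * Y b ^ 2 ≤ Y' a ^ 2 + (z ^ 2 + c) * Y a ^ 2 := by
  have hd : ∀ x ∈ Icc a b, HasDerivAt (fun x ↦ Y' x ^ 2 + (z ^ 2 + c) * Y x ^ 2)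
      (2 * ((c - p x) * (Y x * Y' x))) x := by
    intro x hx
    refine HasDerivAt.congr_deriv
      (((hY' x hx).pow 2).add (((hY x hx).pow 2).const_mul (z ^ 2 + c))) ?_
    push_cast
    ring
  have hanti : AntitoneOn (fun x ↦ Y' x ^ 2 + (z ^ 2 + c) * Y x ^ 2) (Icc a b) := by
    apply antitoneOn_of_deriv_nonpos (convex_Icc a b)
      (fun x hx ↦ (hd x hx).continuousAt.continuousWithinAt)
    · intro x hx
      rw [interior_Icc] at hx
      exact (hd x (Ioo_subset_Icc_self hx)).differentiableAt.differentiableWithinAt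
    · intro x hx
      rw [interior_Icc] at hx
      have hx' := Ioo_subset_Icc_self hx
      rw [(hd x hx').deriv]
      linarith [hsign x hx']
  exact hanti (left_mem_Icc.2 hab) (right_mem_Icc.2 hab) hab

/-- If `Z * (1 + a s)` decreases along with `a`, then so does `Z * a / (1 + a s)`,
as long as `a s ≤ 1`. -/
lemma weight_le {Z₁ Z₂ a₁ a₂ s : ℝ} (hZ : 0 ≤ Z₁) (ha₂ : 0 ≤ a₂) (ha : a₂ ≤ a₁)
    (ha₁ : a₁ ≤ 1)
    (hs : 0 ≤ s) (hs1 : s ≤ 1) (h : Z₂ * (1 + a₂ * s) ≤ Z₁ * (1 + a₁ * s)) :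
    Z₂ * a₂ / (1 + a₂ * s) ≤ Z₁ * a₁ / (1 + a₁ * s) := by
  have h₂ : 0 < 1 + a₂ * s := by positivity
  have h₁ : 0 < 1 + a₁ * s := by have := ha₂.trans ha; positivity
  have hZ₂ : Z₂ ≤ Z₁ * (1 + a₁ * s) / (1 + a₂ * s) := by rwa [le_div_iff₀ h₂]
  have key : a₂ * (1 + a₁ * s) ^ 2 ≤ a₁ * (1 + a₂ * s) ^ 2 := by
    have : 0 ≤ (a₁ - a₂) * (1 - (a₁ * s) * (a₂ * s)) := by
      apply mul_nonneg (by linarith)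
      have h1 : a₁ * s ≤ 1 := mul_le_one₀ ha₁ hs hs1
      have h2 : a₂ * s ≤ 1 := mul_le_one₀ (ha.trans ha₁) hs hs1
      have h3 : 0 ≤ a₂ * s := by positivity
      have := mul_le_one₀ h1 h3 h2
      linarith
    nlinarith
  rw [div_le_div_iff₀ h₂ h₁]
  have e : Z₂ * (1 + a₂ * s) * (a₂ * (1 + a₁ * s)) ≤ Z₁ * (a₁ * (1 + a₂ * s) ^ 2) := by
    calc _ ≤ Z₁ * (1 + a₁ * s) * (a₂ * (1 + a₁ * s)) := by
          apply mul_le_mul_of_nonneg_right h; positivity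
      _ = Z₁ * (a₂ * (1 + a₁ * s) ^ 2) := by ring
      _ ≤ _ := mul_le_mul_of_nonneg_left key hZ
  have hprod : (Z₂ * a₂ * (1 + a₁ * s)) * (1 + a₂ * s) ≤ (Z₁ * a₁ * (1 + a₂ * s)) * (1 + a₂ * s) := by
    linarith
  exact le_of_mul_le_mul_right hprod h₂

/-- If `F' = W τ * (sin τ ^ 2 - τ * sin τ * cos τ)` and the nonnegative weight `W` is larger at
`k * π - t` than at the reflected point `k * π + t`, then `F` stays above `F (π / 2)` on
`[π / 2, Θ]`. -/
lemma le_of_reflection {F W : ℝ → ℝ} {Θ : ℝ} (hF : ContinuousOn F (Icc 0 Θ))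
    (hd : ∀ τ ∈ Ioo 0 Θ, HasDerivAt F (W τ * (sin τ ^ 2 - τ * (sin τ * cos τ))) τ)
    (hW0 : ∀ τ ∈ Ioo 0 Θ, 0 ≤ W τ)
    (hW : ∀ (k : ℕ) (t : ℝ), 0 < t → t < π / 2 → (k : ℝ) * π + t < Θ → 1 ≤ k →
      W (k * π + t) ≤ W (k * π - t)) :
    ∀ τ ∈ Icc 0 Θ, π / 2 ≤ τ → F (π / 2) ≤ F τ := by
  have hpi := Real.pi_pos
  have sin_bd : ∀ t, 0 ≤ t → t < π / 2 → t * cos t ≤ sin t := by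
    intro t h0 h1
    have h2 := Real.le_tan h0 h1
    have hc : 0 < cos t := Real.cos_pos_of_mem_Ioo ⟨by linarith, h1⟩
    rw [Real.tan_eq_sin_div_cos, le_div_iff₀ hc] at h2
    exact h2
  have hs : ∀ (k : ℕ) (t : ℝ), sin (k * π - t) ^ 2 = sin t ^ 2 ∧
      sin (k * π - t) * cos (k * π - t) = - (sin t * cos t) ∧ sin (k * π + t) ^ 2 = sin t ^ 2 ∧
      sin (k * π + t) * cos (k * π + t) = sin t * cos t := by
    intro k t
    have h1 : sin (k * π) = 0 := Real.sin_nat_mul_pi k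
    have h2 : cos (k * π) ^ 2 = 1 := by
      have := Real.sin_sq_add_cos_sq (k * π); rw [h1] at this; linarith
    simp only [Real.sin_sub, Real.cos_sub, Real.sin_add, Real.cos_add, h1]
    refine ⟨?_, ?_, ?_, ?_⟩
    · linear_combination (sin t ^ 2) * h2
    · linear_combination (- sin t * cos t) * h2
    · linear_combination (sin t ^ 2) * h2
    · linear_combination (sin t * cos t) * h2
  -- left half windows
  have hleft : ∀ (k : ℕ) (t : ℝ), 1 ≤ k → 0 ≤ t → t ≤ π / 2 → k * π - t ≤ Θ →
      F (k * π - π / 2) ≤ F (k * π - t) := by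
    intro k t hk h0 h1 h2
    have hk' : (1 : ℝ) ≤ k := by exact_mod_cast hk
    have hkpi : π ≤ k * π := by nlinarith
    have hmono : MonotoneOn F (Icc (k * π - π / 2) (k * π - t)) := by
      apply monotoneOn_of_deriv_nonneg (convex_Icc _ _)
        (hF.mono (Icc_subset_Icc (by linarith) h2))
      · intro x hx
        rw [interior_Icc] at hx
        exact (hd x ⟨by linarith [hx.1], by linarith [hx.2]⟩).differentiableAt.differentiableWithinAt
      · intro x hx
        rw [interior_Icc] at hx
        have hx' : x ∈ Ioo 0 Θ := ⟨by linarith [hx.1], by linarith [hx.2]⟩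
        rw [(hd x hx').deriv]
        apply mul_nonneg (hW0 x hx')
        obtain ⟨e1, e2, -, -⟩ := hs k (k * π - x)
        rw [sub_sub_cancel] at e1 e2
        rw [e2]
        have c1 : 0 ≤ sin (k * π - x) :=
          Real.sin_nonneg_of_nonneg_of_le_pi (by linarith [hx.2]) (by linarith [hx.1])
        have c2 : 0 ≤ cos (k * π - x) :=
          Real.cos_nonneg_of_mem_Icc ⟨by linarith [hx.2], by linarith [hx.1]⟩
        have := mul_nonneg hx'.1.le (mul_nonneg c1 c2)
        nlinarith [sq_nonneg (sin x)]
    exact hmono (left_mem_Icc.2 (by linarith)) (right_mem_Icc.2 (by linarith)) (by linarith)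
  have hright : ∀ (k : ℕ) (t : ℝ), 1 ≤ k → 0 ≤ t → t ≤ π / 2 → k * π + t ≤ Θ →
      F (k * π - t) ≤ F (k * π + t) := by
    intro k t hk h0 h1 h2
    have hk' : (1 : ℝ) ≤ k := by exact_mod_cast hk
    have hkpi : π ≤ k * π := by nlinarith
    have hmono : MonotoneOn (fun u ↦ F (k * π + u) - F (k * π - u)) (Icc 0 t) := by
      have hD : ∀ u ∈ Ioo 0 t, HasDerivAt (fun u ↦ F (k * π + u) - F (k * π - u))
          (W (k * π + u) * (sin (k * π + u) ^ 2 - (k * π + u) * (sin (k * π + u) * cos (k * π + u)))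
          + W (k * π - u) *
            (sin (k * π - u) ^ 2 - (k * π - u) * (sin (k * π - u) * cos (k * π - u)))) u := by
        intro u hu
        have g1 := (hd (k * π + u) ⟨by linarith [hu.1], by linarith [hu.2]⟩).comp_const_add (k * π) u
        have g2 := (hd (k * π - u) ⟨by linarith [hu.1, hu.2], by linarith [hu.1, hu.2]⟩).comp_const_sub
          (k * π) u
        exact (g1.sub g2).congr_deriv (by ring)
      apply monotoneOn_of_deriv_nonneg (convex_Icc _ _)
      · apply ContinuousOn.sub
        · apply hF.comp (by fun_prop)
          intro u hu
          exact ⟨by linarith [hu.1], by linarith [hu.2]⟩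
        · apply hF.comp (by fun_prop)
          intro u hu
          exact ⟨by linarith [hu.1, hu.2], by linarith [hu.1, hu.2]⟩
      · intro u hu
        rw [interior_Icc] at hu
        exact (hD u hu).differentiableAt.differentiableWithinAt
      · intro u hu
        rw [interior_Icc] at hu
        rw [(hD u hu).deriv]
        obtain ⟨e1, e2, e3, e4⟩ := hs k u
        rw [e1, e2, e3, e4]
        have hu2 : u < π / 2 := by linarith [hu.2]
        have w1 := hW k u hu.1 hu2 (by linarith [hu.2]) hk
        have w0 := hW0 (k * π + u) ⟨by linarith [hu.1], by linarith [hu.2]⟩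
        have c1 : 0 ≤ sin u := Real.sin_nonneg_of_nonneg_of_le_pi hu.1.le (by linarith)
        have c2 : 0 ≤ cos u := Real.cos_nonneg_of_mem_Icc ⟨by linarith [hu.1], hu2.le⟩
        have c3 := sin_bd u hu.1.le hu2
        have p1 : 0 ≤ sin u ^ 2 - (k * π - u) * -(sin u * cos u) := by
          have : 0 ≤ (k * π - u) * (sin u * cos u) :=
            mul_nonneg (by linarith) (mul_nonneg c1 c2)
          nlinarith [sq_nonneg (sin u)]
        have p2 : 0 ≤ 2 * (sin u * (sin u - u * cos u)) :=
          mul_nonneg zero_le_two (mul_nonneg c1 (by linarith))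
        have p3 := mul_le_mul_of_nonneg_right w1 p1
        have p4 := mul_nonneg w0 p2
        nlinarith
    have := hmono (left_mem_Icc.2 h0) (right_mem_Icc.2 h0) h0
    simp only [add_zero, sub_zero, sub_self] at this
    linarith
  have main : ∀ k : ℕ, ∀ τ ∈ Icc 0 Θ, π / 2 ≤ τ → τ ≤ k * π + π / 2 → F (π / 2) ≤ F τ := by
    intro k
    induction k with
    | zero =>
      intro τ hτ h1 h2
      have : τ = π / 2 := by simp at h2; linarith
      rw [this]
    | succ k ih =>
      intro τ hτ h1 h2
      by_cases hk : τ ≤ k * π + π / 2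
      · exact ih τ hτ h1 hk
      push Not at hk
      have e : ((k + 1 : ℕ) : ℝ) * π - π / 2 = k * π + π / 2 := by push_cast; ring
      have e' : ((k + 1 : ℕ) : ℝ) * π = k * π + π := by push_cast; ring
      have hk0 : 0 ≤ k * π := by positivity
      have hstart : F (π / 2) ≤ F (((k + 1 : ℕ) : ℝ) * π - π / 2) := by
        rw [e]
        exact ih _ ⟨by positivity, by linarith [hτ.2]⟩ (by linarith) le_rfl
      refine hstart.trans ?_
      rcases le_total τ (((k + 1 : ℕ) : ℝ) * π) with hc | hc
      · have := hleft (k + 1) ((k + 1 : ℕ) * π - τ) (by omega) (by linarith) (by linarith)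
          (by linarith [hτ.2])
        rwa [sub_sub_cancel] at this
      · have a1 := hleft (k + 1) (τ - (k + 1 : ℕ) * π) (by omega) (by linarith) (by linarith)
          (by linarith [hτ.2])
        have a2 := hright (k + 1) (τ - (k + 1 : ℕ) * π) (by omega) (by linarith) (by linarith)
          (by linarith [hτ.2])
        rw [add_sub_cancel] at a2
        exact a1.trans a2
  intro τ hτ h
  obtain ⟨k, hk⟩ := exists_nat_ge (τ / π)
  refine main k τ hτ h ?_
  rw [div_le_iff₀ hpi] at hk
  linarith

/-- Let `r`, `θ` be polar coordinates of `(Y, Y' / z)` for a solution of `Y'' + (z ^ 2 + p) Y = 0`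
with `p` nonnegative, decreasing, at most `z ^ 2` and not identically zero. Then the integral of
`2 p Y (Y - θ Y' / z)` over `[0, 1]` is positive. -/
lemma defect_pos {p Y Y' r θ T : ℝ → ℝ} {z x₁ : ℝ} (hz : 0 < z)
    (hp_anti : AntitoneOn p (Icc 0 1)) (hp0 : ∀ x ∈ Icc (0 : ℝ) 1, 0 ≤ p x)
    (hpz : ∀ x ∈ Icc (0 : ℝ) 1, p x ≤ z ^ 2) (hx₁ : x₁ ∈ Ioc (0 : ℝ) 1) (hpx₁ : 0 < p x₁)
    (hY : ∀ x ∈ Icc (0 : ℝ) 1, HasDerivAt Y (Y' x) x)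
    (hY' : ∀ x ∈ Icc (0 : ℝ) 1, HasDerivAt Y' (-(z ^ 2 + p x) * Y x) x)
    (hr : ∀ x ∈ Icc (0 : ℝ) 1, 0 < r x)
    (hYr : ∀ x ∈ Icc (0 : ℝ) 1, Y x = r x * sin (θ x))
    (hYr' : ∀ x ∈ Icc (0 : ℝ) 1, Y' x = z * (r x * cos (θ x)))
    (hθ0 : θ 0 = 0)
    (hθ : ∀ x ∈ Icc (0 : ℝ) 1, HasDerivAt θ (z + p x / z * sin (θ x) ^ 2) x)
    (hT0 : T 0 = 0)
    (hT : ∀ x ∈ Icc (0 : ℝ) 1, HasDerivAt T (2 * p x * Y x * (Y x - θ x * (Y' x / z))) x) :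
    0 < T 1 := by
  have hpi := Real.pi_pos
  have hθ'_ge : ∀ x ∈ Icc (0 : ℝ) 1, z ≤ z + p x / z * sin (θ x) ^ 2 := by
    intro x hx
    have := hp0 x hx
    have : 0 ≤ p x / z * sin (θ x) ^ 2 := by positivity
    linarith
  have hθc : ContinuousOn θ (Icc 0 1) := fun x hx ↦ (hθ x hx).continuousAt.continuousWithinAt
  have hexp : ∀ x ∈ Icc (0 : ℝ) 1, ∀ y ∈ Icc (0 : ℝ) 1, x ≤ y → z * (y - x) ≤ θ y - θ x := by
    apply Convex.mul_sub_le_image_sub_of_le_deriv (convex_Icc _ _) hθc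
    · intro x hx
      rw [interior_Icc] at hx
      exact (hθ x (Ioo_subset_Icc_self hx)).differentiableAt.differentiableWithinAt
    · intro x hx
      rw [interior_Icc] at hx
      rw [(hθ x (Ioo_subset_Icc_self hx)).deriv]
      exact hθ'_ge x (Ioo_subset_Icc_self hx)
  have hmono : StrictMonoOn θ (Icc 0 1) := by
    intro x hx y hy hxy
    have := hexp x hx y hy hxy.le
    have : 0 < z * (y - x) := mul_pos hz (by linarith)
    linarith
  have h0mem : (0 : ℝ) ∈ Icc (0 : ℝ) 1 := by simp
  have h1mem : (1 : ℝ) ∈ Icc (0 : ℝ) 1 := by simp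
  set Θ := θ 1 with hΘ
  have hΘpos : 0 < Θ := by have := hmono h0mem h1mem one_pos; rwa [hθ0] at this
  have hsurj : ∀ τ, ∃ x, τ ∈ Icc 0 Θ → x ∈ Icc (0 : ℝ) 1 ∧ θ x = τ := by
    intro τ
    by_cases h : τ ∈ Icc 0 Θ
    · have := intermediate_value_Icc zero_le_one hθc
      rw [hθ0] at this
      obtain ⟨x, hx, hx'⟩ := this h
      exact ⟨x, fun _ ↦ ⟨hx, hx'⟩⟩
    · exact ⟨0, fun h' ↦ absurd h' h⟩
  choose X hX using hsurj
  have hXθ : ∀ x ∈ Icc (0 : ℝ) 1, X (θ x) = x := by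
    intro x hx
    have hm : θ x ∈ Icc 0 Θ := by
      refine ⟨?_, hmono.monotoneOn hx h1mem hx.2⟩
      have := hmono.monotoneOn h0mem hx hx.1
      rwa [hθ0] at this
    exact hmono.injOn (hX _ hm).1 hx (hX _ hm).2
  have hXmono : ∀ τ ∈ Icc 0 Θ, ∀ σ ∈ Icc 0 Θ, τ ≤ σ → X τ ≤ X σ := by
    intro τ hτ σ hσ h
    rw [← hmono.le_iff_le (hX _ hτ).1 (hX _ hσ).1, (hX _ hτ).2, (hX _ hσ).2]
    exact h
  have hXlip : LipschitzOnWith (Real.toNNReal z⁻¹) X (Icc 0 Θ) := by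
    apply LipschitzOnWith.of_dist_le_mul
    have key : ∀ τ ∈ Icc 0 Θ, ∀ σ ∈ Icc 0 Θ, τ ≤ σ → X σ - X τ ≤ z⁻¹ * (σ - τ) := by
      intro τ hτ σ hσ h
      have := hexp _ (hX τ hτ).1 _ (hX σ hσ).1 (hXmono τ hτ σ hσ h)
      rw [(hX τ hτ).2, (hX σ hσ).2] at this
      rw [inv_mul_eq_div, le_div_iff₀ hz]
      linarith
    intro τ hτ σ hσ
    rw [Real.coe_toNNReal _ (inv_nonneg.2 hz.le), Real.dist_eq, Real.dist_eq]
    rcases le_total τ σ with h | h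
    · rw [abs_sub_comm, abs_sub_comm τ, abs_of_nonneg (sub_nonneg.2 (hXmono τ hτ σ hσ h)),
        abs_of_nonneg (sub_nonneg.2 h)]
      exact key τ hτ σ hσ h
    · rw [abs_of_nonneg (sub_nonneg.2 (hXmono σ hσ τ hτ h)), abs_of_nonneg (sub_nonneg.2 h)]
      exact key σ hσ τ hτ h
  have hXc : ContinuousOn X (Icc 0 Θ) := hXlip.continuousOn
  have hTc : ContinuousOn T (Icc 0 1) := fun x hx ↦ (hT x hx).continuousAt.continuousWithinAt
  have hXd : ∀ τ ∈ Ioo 0 Θ, HasDerivAt X (z + p (X τ) / z * sin τ ^ 2)⁻¹ τ := by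
    intro τ hτ
    have hτ' := Ioo_subset_Icc_self hτ
    have hn : Icc 0 Θ ∈ 𝓝 τ := Icc_mem_nhds hτ.1 hτ.2
    have h1 := hθ (X τ) (hX τ hτ').1
    rw [(hX τ hτ').2] at h1
    apply HasDerivAt.of_local_left_inverse (hXc.continuousAt hn) h1
    · have := hθ'_ge (X τ) (hX τ hτ').1
      rw [(hX τ hτ').2] at this
      exact (hz.trans_le this).ne'
    · filter_upwards [hn] with σ hσ using (hX σ hσ).2
  have hT'_eq : ∀ x ∈ Icc (0 : ℝ) 1, 2 * p x * Y x * (Y x - θ x * (Y' x / z)) =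
      2 * p x * r x ^ 2 * (sin (θ x) ^ 2 - θ x * (sin (θ x) * cos (θ x))) := by
    intro x hx
    rw [hYr x hx, hYr' x hx, mul_div_cancel_left₀ _ hz.ne']
    ring
  -- the energy at a point
  have henergy : ∀ x ∈ Icc (0 : ℝ) 1, Y' x ^ 2 + (z ^ 2 + p x) * Y x ^ 2 =
      z ^ 2 * (r x ^ 2 * (1 + p x / z ^ 2 * sin (θ x) ^ 2)) := by
    intro x hx
    rw [hYr x hx, hYr' x hx]
    have := Real.sin_sq_add_cos_sq (θ x)
    have e : p x = z ^ 2 * (p x / z ^ 2) := by field_simp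
    linear_combination (z ^ 2 * r x ^ 2) * this + r x ^ 2 * sin (θ x) ^ 2 * e
  have hYY' : ∀ x ∈ Icc (0 : ℝ) 1, Y x * Y' x = z * r x ^ 2 * (sin (θ x) * cos (θ x)) := by
    intro x hx
    rw [hYr x hx, hYr' x hx]; ring
  -- the window comparison
  have hwin := le_of_reflection (F := fun τ ↦ T (X τ)) (Θ := Θ)
    (W := fun τ ↦ 2 * z * (r (X τ) ^ 2 * (p (X τ) / z ^ 2) / (1 + p (X τ) / z ^ 2 * sin τ ^ 2)))
    (hTc.comp hXc fun τ hτ ↦ (hX τ hτ).1)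
    (by
      intro τ hτ
      have hτ' := Ioo_subset_Icc_self hτ
      have h1 := (hT (X τ) (hX τ hτ').1).comp τ (hXd τ hτ)
      refine HasDerivAt.congr_deriv h1 ?_
      rw [hT'_eq _ (hX τ hτ').1, (hX τ hτ').2]
      have hp' := hp0 _ (hX τ hτ').1
      have d1 : z + p (X τ) / z * sin τ ^ 2 = z * (1 + p (X τ) / z ^ 2 * sin τ ^ 2) := by
        field_simp
      have d2 : 0 < 1 + p (X τ) / z ^ 2 * sin τ ^ 2 := by positivity
      rw [d1]
      field_simp)
    (by
      intro τ hτ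
      have hp' := hp0 _ (hX τ (Ioo_subset_Icc_self hτ)).1
      positivity)
    (by
      intro k t ht0 ht1 htΘ hk
      have hk' : (1 : ℝ) ≤ k := by exact_mod_cast hk
      have hkpi : π ≤ k * π := by nlinarith
      have m1 : (k : ℝ) * π - t ∈ Icc 0 Θ := ⟨by linarith, by linarith⟩
      have m2 : (k : ℝ) * π ∈ Icc 0 Θ := ⟨by linarith, by linarith⟩
      have m3 : (k : ℝ) * π + t ∈ Icc 0 Θ := ⟨by linarith, by linarith⟩
      obtain ⟨x1, e1⟩ := hX _ m1
      obtain ⟨x2, e2⟩ := hX _ m2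
      obtain ⟨x3, e3⟩ := hX _ m3
      have l12 := hXmono _ m1 _ m2 (by linarith)
      have l23 := hXmono _ m2 _ m3 (by linarith)
      have s0 : sin ((k : ℝ) * π) = 0 := Real.sin_nat_mul_pi k
      have c0 : cos ((k : ℝ) * π) ^ 2 = 1 := by
        have := Real.sin_sq_add_cos_sq (k * π); rw [s0] at this; linarith
      have s1 : sin (k * π - t) ^ 2 = sin t ^ 2 := by
        rw [Real.sin_sub, s0]; linear_combination sin t ^ 2 * c0
      have s3 : sin (k * π + t) ^ 2 = sin t ^ 2 := by
        rw [Real.sin_add, s0]; linear_combination sin t ^ 2 * c0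
      have sc : ∀ u, sin (k * π + u) * cos (k * π + u) = sin u * cos u := by
        intro u
        rw [Real.sin_add, Real.cos_add, s0]; linear_combination sin u * cos u * c0
      set a := X (k * π - t)
      set b := X (k * π)
      set c := X (k * π + t)
      have sub1 : Icc a b ⊆ Icc 0 1 := Icc_subset_Icc x1.1 x2.2
      have sub2 : Icc b c ⊆ Icc 0 1 := Icc_subset_Icc x2.1 x3.2
      have E1 := energy_le (c := p a) l12 (fun x hx ↦ hY x (sub1 hx)) (fun x hx ↦ hY' x (sub1 hx))
        (by
          intro x hx
          have hx' := sub1 hx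
          have g1 : p x ≤ p a := hp_anti x1 hx' hx.1
          have g2 := hmono.monotoneOn x1 hx' hx.1
          have g3 := hmono.monotoneOn hx' x2 hx.2
          rw [e1] at g2
          rw [e2] at g3
          have g4 : sin (θ x) * cos (θ x) ≤ 0 := by
            have := sc (θ x - k * π)
            rw [add_sub_cancel] at this
            rw [this]
            apply mul_nonpos_of_nonpos_of_nonneg
            · exact Real.sin_nonpos_of_nonpos_of_neg_pi_le (by linarith) (by linarith)
            · exact Real.cos_nonneg_of_mem_Icc ⟨by linarith, by linarith⟩
          rw [hYY' x hx']
          exact mul_nonpos_of_nonneg_of_nonpos (by linarith)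
            (mul_nonpos_of_nonneg_of_nonpos (by positivity) g4))
      have E2 := energy_le (c := p c) l23 (fun x hx ↦ hY x (sub2 hx)) (fun x hx ↦ hY' x (sub2 hx))
        (by
          intro x hx
          have hx' := sub2 hx
          have g1 : p c ≤ p x := hp_anti hx' x3 hx.2
          have g2 := hmono.monotoneOn x2 hx' hx.1
          have g3 := hmono.monotoneOn hx' x3 hx.2
          rw [e2] at g2
          rw [e3] at g3
          have g4 : 0 ≤ sin (θ x) * cos (θ x) := by
            have := sc (θ x - k * π)
            rw [add_sub_cancel] at this
            rw [this]
            apply mul_nonneg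
            · exact Real.sin_nonneg_of_nonneg_of_le_pi (by linarith) (by linarith)
            · exact Real.cos_nonneg_of_mem_Icc ⟨by linarith, by linarith⟩
          rw [hYY' x hx']
          exact mul_nonpos_of_nonpos_of_nonneg (by linarith)
            (mul_nonneg (by positivity) g4))
      have Yb : Y b = 0 := by rw [hYr b x2, e2, s0, mul_zero]
      rw [henergy a x1, e1, s1] at E1
      rw [henergy c x3, e3, s3] at E2
      rw [Yb] at E1 E2
      have hE : r c ^ 2 * (1 + p c / z ^ 2 * sin t ^ 2) ≤ r a ^ 2 * (1 + p a / z ^ 2 * sin t ^ 2) := by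
        have : 0 < z ^ 2 := by positivity
        refine le_of_mul_le_mul_left ?_ this
        linarith
      have pc := hp0 c x3
      have := weight_le (sq_nonneg (r a)) (by positivity : 0 ≤ p c / z ^ 2)
        (by
          have : p c ≤ p a := hp_anti x1 x3 (l12.trans l23)
          gcongr)
        (by rw [div_le_one (by positivity)]; exact hpz a x1)
        (sq_nonneg (sin t)) (Real.sin_sq_le_one t) hE
      show 2 * z * (r c ^ 2 * (p c / z ^ 2) / (1 + p c / z ^ 2 * sin (k * π + t) ^ 2)) ≤
        2 * z * (r a ^ 2 * (p a / z ^ 2) / (1 + p a / z ^ 2 * sin (k * π - t) ^ 2))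
      rw [s1, s3]
      exact mul_le_mul_of_nonneg_left this (by positivity))
  -- positivity at the first quarter period
  have hstart : ∀ x ∈ Ioc (0 : ℝ) 1, θ x ≤ π / 2 → 0 < T x := by
    intro x hx hxθ
    have hxI : x ∈ Icc (0 : ℝ) 1 := Ioc_subset_Icc_self hx
    have hpos : ∀ y ∈ Ioo 0 x, 0 < sin (θ y) ^ 2 - θ y * (sin (θ y) * cos (θ y)) := by
      intro y hy
      have hy' : y ∈ Icc (0 : ℝ) 1 := ⟨hy.1.le, hy.2.le.trans hx.2⟩
      have g1 := hmono h0mem hy' hy.1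
      have g2 := hmono hy' hxI hy.2
      rw [hθ0] at g1
      have hs : 0 < sin (θ y) := Real.sin_pos_of_pos_of_lt_pi g1 (by linarith)
      have hc : 0 < cos (θ y) := Real.cos_pos_of_mem_Ioo ⟨by linarith, by linarith⟩
      have h3 := Real.lt_tan g1 (by linarith)
      rw [Real.tan_eq_sin_div_cos, lt_div_iff₀ hc] at h3
      have := mul_pos hs (sub_pos.2 h3)
      linarith
    have hmonoT : MonotoneOn T (Icc 0 x) := by
      apply monotoneOn_of_deriv_nonneg (convex_Icc _ _) (hTc.mono (Icc_subset_Icc le_rfl hx.2))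
      · intro y hy
        rw [interior_Icc] at hy
        exact (hT y ⟨hy.1.le, hy.2.le.trans hx.2⟩).differentiableAt.differentiableWithinAt
      · intro y hy
        rw [interior_Icc] at hy
        have hy' : y ∈ Icc (0 : ℝ) 1 := ⟨hy.1.le, hy.2.le.trans hx.2⟩
        rw [(hT y hy').deriv, hT'_eq y hy']
        have := hp0 y hy'
        have := hpos y hy
        positivity
    have hx3 : 0 < min x x₁ := lt_min hx.1 hx₁.1
    have hstrict : StrictMonoOn T (Icc 0 (min x x₁)) := by
      apply strictMonoOn_of_deriv_pos (convex_Icc _ _)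
        (hTc.mono (Icc_subset_Icc le_rfl ((min_le_left _ _).trans hx.2)))
      intro y hy
      rw [interior_Icc] at hy
      have hyx : y < x := hy.2.trans_le (min_le_left _ _)
      have hy' : y ∈ Icc (0 : ℝ) 1 := ⟨hy.1.le, hyx.le.trans hx.2⟩
      rw [(hT y hy').deriv, hT'_eq y hy']
      have h1 : 0 < p y := hpx₁.trans_le
        (hp_anti hy' (Ioc_subset_Icc_self hx₁) (hy.2.trans_le (min_le_right _ _)).le)
      have := hpos y ⟨hy.1, hyx⟩
      have := hr y hy'
      positivity
    have a1 := hstrict (left_mem_Icc.2 hx3.le) (right_mem_Icc.2 hx3.le) hx3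
    have a2 := hmonoT ⟨hx3.le, min_le_left _ _⟩ (right_mem_Icc.2 hx.1.le) (min_le_left _ _)
    rw [hT0] at a1
    exact a1.trans_le a2
  rcases le_total Θ (π / 2) with h | h
  · exact hstart 1 ⟨one_pos, le_rfl⟩ h
  · have hm : π / 2 ∈ Icc 0 Θ := ⟨by positivity, h⟩
    have h1 := hwin Θ ⟨hΘpos.le, le_rfl⟩ h
    simp only [hΘ, hXθ 1 h1mem] at h1
    refine lt_of_lt_of_le (hstart (X (π / 2)) ⟨?_, (hX _ hm).1.2⟩ (hX _ hm).2.le) h1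
    refine lt_of_le_of_ne (hX _ hm).1.1 fun e ↦ ?_
    have := (hX _ hm).2
    rw [← e, hθ0] at this
    linarith

/-- The Prüfer angle of the solution of `-y'' + Q y = lam y` on `[0, 1]` that vanishes at `0`. -/
structure IsPruferAngle (Q : ℝ → ℝ) (lam : ℝ) (θ : ℝ → ℝ) : Prop where
  continuous : Continuous θ
  zero : θ 0 = 0
  hasDerivAt : ∀ x ∈ Icc (0 : ℝ) 1,
    HasDerivAt θ (cos (θ x) ^ 2 + (lam - Q x) * sin (θ x) ^ 2) x

lemma sin_sq_sub_sin_sq (a b : ℝ) : sin a ^ 2 - sin b ^ 2 = sin (a + b) * sin (a - b) := by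
  rw [Real.sin_add, Real.sin_sub]
  linear_combination (sin b ^ 2) * Real.sin_sq_add_cos_sq a
    - (sin a ^ 2) * Real.sin_sq_add_cos_sq b

lemma abs_sin_sq_sub_sin_sq_le (a b : ℝ) : |sin a ^ 2 - sin b ^ 2| ≤ |a - b| := by
  rw [sin_sq_sub_sin_sq, abs_mul]
  calc _ ≤ 1 * |a - b| :=
        mul_le_mul (Real.abs_sin_le_one _) Real.abs_sin_le_abs (abs_nonneg _) zero_le_one
    _ = _ := one_mul _

lemma exists_isPruferAngle {Q : ℝ → ℝ} (hQ : Continuous Q) {M : ℝ} (hM : ∀ x, |Q x| ≤ M)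
    (lam : ℝ) : ∃ θ, IsPruferAngle Q lam θ := by
  have hM0 : 0 ≤ M := (abs_nonneg _).trans (hM 0)
  have hc : ∀ x, |lam - Q x| ≤ |lam| + M := fun x ↦ (abs_sub _ _).trans (by linarith [hM x])
  have hP : IsPicardLindelof (fun x t : ℝ ↦ cos t ^ 2 + (lam - Q x) * sin t ^ 2)
      (tmin := -1) (tmax := 2) ⟨0, by norm_num⟩ (0 : ℝ)
      (Real.toNNReal (2 * (1 + |lam| + M))) 0 (Real.toNNReal (1 + |lam| + M))
      (Real.toNNReal (1 + |lam| + M)) := by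
    constructor
    · intro x _
      apply LipschitzOnWith.of_dist_le_mul
      intro a _ b _
      rw [Real.coe_toNNReal _ (by positivity), Real.dist_eq, Real.dist_eq]
      have e : cos a ^ 2 + (lam - Q x) * sin a ^ 2 - (cos b ^ 2 + (lam - Q x) * sin b ^ 2) =
          (lam - Q x - 1) * (sin a ^ 2 - sin b ^ 2) := by
        linear_combination Real.sin_sq_add_cos_sq a - Real.sin_sq_add_cos_sq b
      rw [e, abs_mul]
      refine mul_le_mul ?_ (abs_sin_sq_sub_sin_sq_le a b) (abs_nonneg _) (by positivity)
      have := abs_sub (lam - Q x) 1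
      rw [abs_one] at this
      linarith [hc x]
    · intro t _
      fun_prop
    · intro x _ t _
      rw [Real.coe_toNNReal _ (by positivity), Real.norm_eq_abs]
      have h1 : |cos t ^ 2| ≤ 1 := by
        rw [abs_of_nonneg (sq_nonneg _)]; exact Real.cos_sq_le_one t
      have h2 : |sin t ^ 2| ≤ 1 := by
        rw [abs_of_nonneg (sq_nonneg _)]; exact Real.sin_sq_le_one t
      calc _ ≤ |cos t ^ 2| + |(lam - Q x) * sin t ^ 2| := abs_add_le _ _
        _ ≤ 1 + (|lam| + M) * 1 := by
          rw [abs_mul]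
          gcongr
          exact hc x
        _ = _ := by ring
    · rw [Real.coe_toNNReal _ (by positivity), Real.coe_toNNReal _ (by positivity)]
      norm_num
      linarith
  obtain ⟨α, h0, hα⟩ := hP.exists_eq_forall_mem_Icc_hasDerivWithinAt₀
  have hαc : ContinuousOn α (Icc (-1) 2) := fun x hx ↦ (hα x hx).continuousWithinAt
  refine ⟨fun x ↦ α (projIcc (-1 : ℝ) 2 (by norm_num) x), ?_, ?_, ?_⟩
  · exact (continuousOn_iff_continuous_domRestrict.1 hαc).comp continuous_projIcc
  · rw [projIcc_of_mem _ (by norm_num : (0 : ℝ) ∈ Icc (-1 : ℝ) 2)]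
    exact h0
  · intro x hx
    have hx' : x ∈ Ioo (-1 : ℝ) 2 := ⟨by linarith [hx.1], by linarith [hx.2]⟩
    have hn : Icc (-1 : ℝ) 2 ∈ 𝓝 x := Icc_mem_nhds hx'.1 hx'.2
    rw [projIcc_of_mem _ (Ioo_subset_Icc_self hx')]
    refine ((hα x (Ioo_subset_Icc_self hx')).hasDerivAt hn).congr_of_eventuallyEq ?_
    filter_upwards [hn] with y hy
    rw [projIcc_of_mem _ hy]

/-- The logarithm of the Prüfer radius, normalised to vanish at `0`. -/
noncomputable def logRadius (Q : ℝ → ℝ) (lam : ℝ) (θ : ℝ → ℝ) (x : ℝ) : ℝ :=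
  ∫ t in (0 : ℝ)..x, (1 + Q t - lam) * (sin (θ t) * cos (θ t))

/-- The solution with Prüfer angle `θ`. -/
noncomputable def pruferSol (Q : ℝ → ℝ) (lam : ℝ) (θ : ℝ → ℝ) (x : ℝ) : ℝ :=
  exp (logRadius Q lam θ x) * sin (θ x)

/-- The derivative of the solution with Prüfer angle `θ`. -/
noncomputable def pruferSol' (Q : ℝ → ℝ) (lam : ℝ) (θ : ℝ → ℝ) (x : ℝ) : ℝ :=
  exp (logRadius Q lam θ x) * cos (θ x)

namespace IsPruferAngle

variable {Q : ℝ → ℝ} {lam : ℝ} {θ : ℝ → ℝ}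

lemma hasDerivAt_logRadius (hQ : Continuous Q) (h : IsPruferAngle Q lam θ) (x : ℝ) :
    HasDerivAt (logRadius Q lam θ) ((1 + Q x - lam) * (sin (θ x) * cos (θ x))) x := by
  have hc := h.continuous
  have : Continuous fun t ↦ (1 + Q t - lam) * (sin (θ t) * cos (θ t)) := by fun_prop
  exact intervalIntegral.integral_hasDerivAt_right (this.intervalIntegrable _ _)
    (this.stronglyMeasurableAtFilter _ _) this.continuousAt

lemma continuous_pruferSol (hQ : Continuous Q) (h : IsPruferAngle Q lam θ) :
    Continuous (pruferSol Q lam θ) := by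
  have h1 : Continuous (logRadius Q lam θ) :=
    continuous_iff_continuousAt.2 fun x ↦ (h.hasDerivAt_logRadius hQ x).continuousAt
  have h2 := h.continuous
  unfold pruferSol
  fun_prop

lemma hasDerivAt_pruferSol (hQ : Continuous Q) (h : IsPruferAngle Q lam θ) {x : ℝ}
    (hx : x ∈ Icc (0 : ℝ) 1) :
    HasDerivAt (pruferSol Q lam θ) (pruferSol' Q lam θ x) x := by
  refine HasDerivAt.congr_deriv
    ((h.hasDerivAt_logRadius hQ x).exp.mul (h.hasDerivAt x hx).sin) ?_
  unfold pruferSol'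
  linear_combination (exp (logRadius Q lam θ x) * cos (θ x)) * Real.sin_sq_add_cos_sq (θ x)

lemma hasDerivAt_pruferSol' (hQ : Continuous Q) (h : IsPruferAngle Q lam θ) {x : ℝ}
    (hx : x ∈ Icc (0 : ℝ) 1) :
    HasDerivAt (pruferSol' Q lam θ) ((Q x - lam) * pruferSol Q lam θ x) x := by
  refine HasDerivAt.congr_deriv
    ((h.hasDerivAt_logRadius hQ x).exp.mul (h.hasDerivAt x hx).cos) ?_
  unfold pruferSol
  linear_combination (exp (logRadius Q lam θ x) * sin (θ x) * (Q x - lam)) *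
    Real.sin_sq_add_cos_sq (θ x)

lemma abs_sub_le {θ₀ : ℝ → ℝ} {lam₀ M : ℝ} (hM : ∀ x, |Q x| ≤ M)
    (h₀ : IsPruferAngle Q lam₀ θ₀) (h : IsPruferAngle Q lam θ) :
    ∀ x ∈ Icc (0 : ℝ) 1, |θ x - θ₀ x| ≤
      |lam - lam₀| * ((exp (1 + |lam₀| + M)) / (1 + |lam₀| + M)) := by
  have hM0 : 0 ≤ M := (abs_nonneg _).trans (hM 0)
  set K := 1 + |lam₀| + M with hK
  have hKpos : 0 < K := by positivity
  have hd : ∀ x ∈ Icc (0 : ℝ) 1, HasDerivAt (fun x ↦ θ x - θ₀ x)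
      ((lam₀ - Q x - 1) * (sin (θ x) ^ 2 - sin (θ₀ x) ^ 2) + (lam - lam₀) * sin (θ x) ^ 2) x := by
    intro x hx
    refine HasDerivAt.congr_deriv ((h.hasDerivAt x hx).sub (h₀.hasDerivAt x hx)) ?_
    linear_combination Real.sin_sq_add_cos_sq (θ x) - Real.sin_sq_add_cos_sq (θ₀ x)
  have := norm_le_gronwallBound_of_norm_deriv_right_le (K := K) (ε := |lam - lam₀|) (δ := 0)
    (fun x hx ↦ (hd x hx).continuousAt.continuousWithinAt)
    (fun x hx ↦ (hd x (Ico_subset_Icc_self hx)).hasDerivWithinAt)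
    (by simp [h.zero, h₀.zero])
    (by
      intro x hx
      simp only [Real.norm_eq_abs]
      refine (abs_add_le _ _).trans (add_le_add ?_ ?_)
      · rw [abs_mul]
        refine mul_le_mul ?_ (abs_sin_sq_sub_sin_sq_le _ _) (abs_nonneg _) hKpos.le
        have h1 := abs_sub (lam₀ - Q x) 1
        have h2 := abs_sub lam₀ (Q x)
        rw [abs_one] at h1
        linarith [hM x]
      · rw [abs_mul, abs_of_nonneg (sq_nonneg (sin (θ x)))]
        exact mul_le_of_le_one_right (abs_nonneg _) (Real.sin_sq_le_one _))
  intro x hx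
  refine (this x hx).trans ?_
  simp only [gronwallBound_of_K_ne_0 hKpos.ne', sub_zero, zero_mul, zero_add]
  have e1 : exp (K * x) - 1 ≤ exp K := by
    have : exp (K * x) ≤ exp K := Real.exp_le_exp.2 (mul_le_of_le_one_right hKpos.le hx.2)
    linarith
  calc _ ≤ |lam - lam₀| / K * exp K := by gcongr
    _ = _ := by ring

lemma abs_logRadius_le {M : ℝ} (hM : ∀ x, |Q x| ≤ M) (x : ℝ) (hx : x ∈ Icc (0 : ℝ) 1) :
    |logRadius Q lam θ x| ≤ 1 + M + |lam| := by
  have hM0 : 0 ≤ M := (abs_nonneg _).trans (hM 0)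
  have := intervalIntegral.norm_integral_le_of_norm_le_const (a := 0) (b := x)
    (f := fun t ↦ (1 + Q t - lam) * (sin (θ t) * cos (θ t))) (C := 1 + M + |lam|) (by
      intro t _
      rw [norm_mul, norm_mul, Real.norm_eq_abs, Real.norm_eq_abs, Real.norm_eq_abs]
      have h1 : |1 + Q t - lam| ≤ 1 + M + |lam| := by
        have a1 := abs_sub (1 + Q t) lam
        have a2 := abs_add_le 1 (Q t)
        rw [abs_one] at a2
        linarith [hM t]
      have h2 : |sin (θ t)| * |cos (θ t)| ≤ 1 :=
        mul_le_one₀ (Real.abs_sin_le_one _) (abs_nonneg _) (Real.abs_cos_le_one _)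
      exact (mul_le_of_le_one_right (abs_nonneg _) h2).trans h1)
  refine this.trans ?_
  rw [sub_zero, abs_of_nonneg hx.1]
  exact mul_le_of_le_one_right (by positivity) hx.2

lemma abs_pruferSol_le {M : ℝ} (hM : ∀ x, |Q x| ≤ M) (x : ℝ) (hx : x ∈ Icc (0 : ℝ) 1) :
    |pruferSol Q lam θ x| ≤ exp (1 + M + |lam|) := by
  unfold pruferSol
  rw [abs_mul, abs_of_pos (Real.exp_pos _)]
  refine (mul_le_of_le_one_right (Real.exp_pos _).le (Real.abs_sin_le_one _)).trans ?_
  exact Real.exp_le_exp.2 ((le_abs_self _).trans (abs_logRadius_le hM x hx))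

/-- Lagrange's identity for two values of the spectral parameter. -/
lemma sin_sub_mul_exp {θ₀ : ℝ → ℝ} {lam₀ : ℝ} (hQ : Continuous Q)
    (h₀ : IsPruferAngle Q lam₀ θ₀) (h : IsPruferAngle Q lam θ) :
    sin (θ 1 - θ₀ 1) * (exp (logRadius Q lam θ 1) * exp (logRadius Q lam₀ θ₀ 1)) =
      (lam - lam₀) * ∫ x in (0 : ℝ)..1, pruferSol Q lam θ x * pruferSol Q lam₀ θ₀ x := by
  have c1 := h.continuous_pruferSol hQ
  have c2 := h₀.continuous_pruferSol hQ
  have hd : ∀ x ∈ uIcc (0 : ℝ) 1, HasDerivAt (fun x ↦ pruferSol Q lam θ x * pruferSol' Q lam₀ θ₀ x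
      - pruferSol' Q lam θ x * pruferSol Q lam₀ θ₀ x)
      ((lam - lam₀) * (pruferSol Q lam θ x * pruferSol Q lam₀ θ₀ x)) x := by
    intro x hx
    rw [uIcc_of_le zero_le_one] at hx
    refine HasDerivAt.congr_deriv
      (((h.hasDerivAt_pruferSol hQ hx).mul (h₀.hasDerivAt_pruferSol' hQ hx)).sub
        ((h.hasDerivAt_pruferSol' hQ hx).mul (h₀.hasDerivAt_pruferSol hQ hx))) ?_
    ring
  have := intervalIntegral.integral_eq_sub_of_hasDerivAt hd
    (Continuous.intervalIntegrable (by fun_prop) _ _)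
  rw [intervalIntegral.integral_const_mul] at this
  rw [this]
  simp only [pruferSol, pruferSol', h.zero, h₀.zero, Real.sin_zero, Real.sin_sub]
  ring

end IsPruferAngle

section Parameter

variable {Q : ℝ → ℝ} {M : ℝ} {θ : ℝ → ℝ → ℝ}

lemma continuousAt_pruferAngle (hM : ∀ x, |Q x| ≤ M)
    (hθ : ∀ lam, IsPruferAngle Q lam (θ lam)) (lam₀ : ℝ) {x : ℝ} (hx : x ∈ Icc (0 : ℝ) 1) :
    ContinuousAt (fun lam ↦ θ lam x) lam₀ := by
  rw [ContinuousAt, tendsto_iff_norm_sub_tendsto_zero]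
  have hlim : Tendsto (fun lam ↦ |lam - lam₀| * ((exp (1 + |lam₀| + M)) / (1 + |lam₀| + M)))
      (𝓝 lam₀) (𝓝 0) := by
    have : ContinuousAt (fun lam ↦
        |lam - lam₀| * ((exp (1 + |lam₀| + M)) / (1 + |lam₀| + M))) lam₀ := by fun_prop
    simpa [ContinuousAt] using this
  exact squeeze_zero (fun _ ↦ norm_nonneg _)
    (fun lam ↦ (hθ lam₀).abs_sub_le hM (hθ lam) x hx) hlim

lemma continuousAt_logRadius (hQ : Continuous Q) (hM : ∀ x, |Q x| ≤ M)
    (hθ : ∀ lam, IsPruferAngle Q lam (θ lam)) (lam₀ : ℝ) {x : ℝ} (hx : x ∈ Icc (0 : ℝ) 1) :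
    ContinuousAt (fun lam ↦ logRadius Q lam (θ lam) x) lam₀ := by
  unfold logRadius
  apply intervalIntegral.continuousAt_of_dominated_interval
    (bound := fun _ ↦ 2 + M + |lam₀|)
  · refine .of_forall fun lam ↦ ?_
    have := (hθ lam).continuous
    exact Continuous.aestronglyMeasurable (by fun_prop)
  · filter_upwards [Metric.ball_mem_nhds lam₀ one_pos] with lam hlam
    refine .of_forall fun t ht ↦ ?_
    rw [Metric.mem_ball, Real.dist_eq] at hlam
    rw [norm_mul, norm_mul, Real.norm_eq_abs, Real.norm_eq_abs, Real.norm_eq_abs]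
    have h1 : |1 + Q t - lam| ≤ 2 + M + |lam₀| := by
      have a0 := abs_sub_abs_le_abs_sub lam lam₀
      have a1 := abs_sub (1 + Q t) lam
      have a2 := abs_add_le 1 (Q t)
      rw [abs_one] at a2
      linarith [hM t]
    have h2 : |sin (θ lam t)| * |cos (θ lam t)| ≤ 1 :=
      mul_le_one₀ (Real.abs_sin_le_one _) (abs_nonneg _) (Real.abs_cos_le_one _)
    exact (mul_le_of_le_one_right (abs_nonneg _) h2).trans h1
  · exact intervalIntegrable_const
  · refine .of_forall fun t ht ↦ ?_
    rw [uIoc_of_le hx.1] at ht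
    have := continuousAt_pruferAngle hM hθ lam₀ (x := t) ⟨ht.1.le, ht.2.trans hx.2⟩
    fun_prop

lemma hasDerivAt_pruferAngle_one (hQ : Continuous Q) (hM : ∀ x, |Q x| ≤ M)
    (hθ : ∀ lam, IsPruferAngle Q lam (θ lam)) (lam₀ : ℝ) :
    HasDerivAt (fun lam ↦ θ lam 1)
      ((∫ x in (0 : ℝ)..1, pruferSol Q lam₀ (θ lam₀) x ^ 2) /
        exp (logRadius Q lam₀ (θ lam₀) 1) ^ 2) lam₀ := by
  have h1mem : (1 : ℝ) ∈ Icc (0 : ℝ) 1 := by simp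
  have hθc := continuousAt_pruferAngle hM hθ lam₀ h1mem
  set I : ℝ → ℝ := fun lam ↦ (∫ x in (0 : ℝ)..1, pruferSol Q lam (θ lam) x *
    pruferSol Q lam₀ (θ lam₀) x) /
      (exp (logRadius Q lam (θ lam) 1) * exp (logRadius Q lam₀ (θ lam₀) 1)) with hI
  have hIeq : ∀ lam, sin (θ lam 1 - θ lam₀ 1) = (lam - lam₀) * I lam := by
    intro lam
    have := (hθ lam₀).sin_sub_mul_exp hQ (hθ lam)
    rw [hI, mul_div_assoc', eq_div_iff (by positivity)]
    exact this
  have hIc : ContinuousAt I lam₀ := by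
    apply ContinuousAt.div
    · apply intervalIntegral.continuousAt_of_dominated_interval
        (bound := fun _ ↦ exp (2 + M + |lam₀|) * exp (1 + M + |lam₀|))
      · refine .of_forall fun lam ↦ ?_
        exact (((hθ lam).continuous_pruferSol hQ).mul
          ((hθ lam₀).continuous_pruferSol hQ)).aestronglyMeasurable
      · filter_upwards [Metric.ball_mem_nhds lam₀ one_pos] with lam hlam
        refine .of_forall fun t ht ↦ ?_
        rw [uIoc_of_le zero_le_one] at ht
        have ht' := Ioc_subset_Icc_self ht
        rw [Metric.mem_ball, Real.dist_eq] at hlam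
        have a0 := abs_sub_abs_le_abs_sub lam lam₀
        rw [norm_mul, Real.norm_eq_abs, Real.norm_eq_abs]
        refine mul_le_mul ((IsPruferAngle.abs_pruferSol_le hM t ht').trans
          (Real.exp_le_exp.2 (by linarith))) (IsPruferAngle.abs_pruferSol_le hM t ht')
          (abs_nonneg _) (Real.exp_pos _).le
      · exact intervalIntegrable_const
      · refine .of_forall fun t ht ↦ ?_
        rw [uIoc_of_le zero_le_one] at ht
        have ht' := Ioc_subset_Icc_self ht
        have h1 := continuousAt_pruferAngle hM hθ lam₀ ht'
        have h2 := continuousAt_logRadius hQ hM hθ lam₀ ht'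
        unfold pruferSol
        fun_prop
    · have h2 := continuousAt_logRadius hQ hM hθ lam₀ h1mem
      fun_prop
    · positivity
  have hg : HasDerivAt (fun lam ↦ sin (θ lam 1 - θ lam₀ 1)) (I lam₀) lam₀ := by
    rw [hasDerivAt_iff_tendsto_slope]
    refine (hIc.tendsto.mono_left nhdsWithin_le_nhds).congr' ?_
    filter_upwards [self_mem_nhdsWithin] with lam hlam
    have hne : lam - lam₀ ≠ 0 := sub_ne_zero.2 hlam
    rw [slope_def_field, hIeq, hIeq, sub_self, zero_mul, sub_zero, mul_div_cancel_left₀ _ hne]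
  have harc : HasDerivAt (fun lam ↦ θ lam₀ 1 + arcsin (sin (θ lam 1 - θ lam₀ 1))) (I lam₀) lam₀ := by
    have h0 : HasDerivAt arcsin 1 (sin (θ lam₀ 1 - θ lam₀ 1)) := by
      have := Real.hasDerivAt_arcsin (x := 0) (by norm_num) (by norm_num)
      simpa using this
    exact ((h0.comp lam₀ hg).const_add _).congr_deriv (one_mul _)
  have hval : I lam₀ = (∫ x in (0 : ℝ)..1, pruferSol Q lam₀ (θ lam₀) x ^ 2) /
        exp (logRadius Q lam₀ (θ lam₀) 1) ^ 2 := by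
    simp only [hI, sq]
  rw [← hval]
  refine harc.congr_of_eventuallyEq ?_
  have hev : ∀ᶠ lam in 𝓝 lam₀, |θ lam 1 - θ lam₀ 1| < π / 2 := by
    have h3 : ContinuousAt (fun lam ↦ |θ lam 1 - θ lam₀ 1|) lam₀ := by fun_prop
    apply h3.eventually_lt continuousAt_const
    simp [Real.pi_pos]
  filter_upwards [hev] with lam hlam
  rw [abs_lt] at hlam
  rw [Real.arcsin_sin (by linarith [hlam.1]) hlam.2.le]
  ring

end Parameter

/-- For `t` with `tan t = Y / Y'`, the angle with tangent `z * Y / Y'` in the same quadrant. -/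
noncomputable def scaledAngle (t z : ℝ) : ℝ :=
  t + arctan ((z - 1) * (sin t * cos t) / (cos t ^ 2 + z * sin t ^ 2))

lemma cos_sq_add_mul_sin_sq_pos {z : ℝ} (hz : 0 < z) (t : ℝ) : 0 < cos t ^ 2 + z * sin t ^ 2 := by
  rcases eq_or_ne (sin t) 0 with h | h
  · have := Real.sin_sq_add_cos_sq t
    rw [h] at this ⊢
    linarith
  · positivity

lemma scaledAngle_aux (t z : ℝ) :
    (cos t ^ 2 + z * sin t ^ 2) ^ 2 + ((z - 1) * (sin t * cos t)) ^ 2 =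
      cos t ^ 2 + z ^ 2 * sin t ^ 2 := by
  linear_combination (cos t ^ 2 + z ^ 2 * sin t ^ 2) * Real.sin_sq_add_cos_sq t

lemma hasDerivAt_scaledAngle {u v : ℝ → ℝ} {u' v' t : ℝ} (hu : HasDerivAt u u' t)
    (hv : HasDerivAt v v' t) (hvt : 0 < v t) :
    HasDerivAt (fun x ↦ scaledAngle (u x) (v x))
      ((v t * u' + v' * (sin (u t) * cos (u t))) / (cos (u t) ^ 2 + v t ^ 2 * sin (u t) ^ 2)) t := by
  have hD := cos_sq_add_mul_sin_sq_pos hvt (u t)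
  have hρ := cos_sq_add_mul_sin_sq_pos (pow_pos hvt 2) (u t)
  have hN := scaledAngle_aux (u t) (v t)
  have h1 := (hv.sub_const 1).mul (hu.sin.mul hu.cos)
  have h2 := (hu.cos.pow 2).add (hv.mul (hu.sin.pow 2))
  refine HasDerivAt.congr_deriv (hu.add (h1.div h2 hD.ne').arctan) ?_
  simp only [Pi.add_apply, Pi.mul_apply, Pi.pow_apply, Pi.div_apply]
  set s := sin (u t)
  set c := cos (u t)
  set D := c ^ 2 + v t * s ^ 2
  set N := (v t - 1) * (s * c)
  have hsc : s ^ 2 + c ^ 2 = 1 := Real.sin_sq_add_cos_sq _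
  have key : ∀ X : ℝ, 1 / (1 + (N / D) ^ 2) * (X / D ^ 2) = X / (D ^ 2 + N ^ 2) := by
    intro X
    field_simp
  rw [key, hN, eq_div_iff hρ.ne', add_mul, div_mul_cancel₀ _ hρ.ne']
  simp only [D, N]
  push_cast
  linear_combination (u' * (v t - 1) * (c ^ 2 - v t * s ^ 2) + v' * (s * c) + u' * v t) * hsc

lemma sin_scaledAngle {z : ℝ} (hz : 0 < z) (t : ℝ) :
    sin (scaledAngle t z) = z * sin t / √(cos t ^ 2 + z ^ 2 * sin t ^ 2) ∧
    cos (scaledAngle t z) = cos t / √(cos t ^ 2 + z ^ 2 * sin t ^ 2) := by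
  have hD := cos_sq_add_mul_sin_sq_pos hz t
  have hρ := cos_sq_add_mul_sin_sq_pos (pow_pos hz 2) t
  have hN := scaledAngle_aux t z
  unfold scaledAngle
  rw [Real.sin_add, Real.cos_add, Real.sin_arctan, Real.cos_arctan]
  have hsq : √(1 + ((z - 1) * (sin t * cos t) / (cos t ^ 2 + z * sin t ^ 2)) ^ 2) =
      √(cos t ^ 2 + z ^ 2 * sin t ^ 2) / (cos t ^ 2 + z * sin t ^ 2) := by
    rw [div_pow, ← hN, one_add_div (by positivity), Real.sqrt_div' _ (by positivity),
      Real.sqrt_sq hD.le]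
  rw [hsq, div_div_div_cancel_right₀ hD.ne', one_div_div]
  have hsc := Real.sin_sq_add_cos_sq t
  constructor
  · linear_combination (z * sin t / √(cos t ^ 2 + z ^ 2 * sin t ^ 2)) * hsc
  · linear_combination (cos t / √(cos t ^ 2 + z ^ 2 * sin t ^ 2)) * hsc

lemma scaledAngle_zero (z : ℝ) : scaledAngle 0 z = 0 := by simp [scaledAngle]

lemma scaledAngle_of_cos_eq_zero {t : ℝ} (ht : cos t = 0) (z : ℝ) : scaledAngle t z = t := by
  simp [scaledAngle, ht]

lemma scaledAngle_le (t z : ℝ) : scaledAngle t z ≤ t + π / 2 := by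
  unfold scaledAngle
  linarith [Real.arctan_lt_pi_div_two ((z - 1) * (sin t * cos t) / (cos t ^ 2 + z * sin t ^ 2))]

namespace IsPruferAngle

variable {Q : ℝ → ℝ} {lam : ℝ} {θ : ℝ → ℝ}

lemma hasDerivAt_scaledAngle {z : ℝ} (hz : 0 < z) (h : IsPruferAngle Q (z ^ 2) θ) {x : ℝ}
    (hx : x ∈ Icc (0 : ℝ) 1) :
    HasDerivAt (fun x ↦ scaledAngle (θ x) z)
      (z + -Q x / z * sin (scaledAngle (θ x) z) ^ 2) x := by
  have hρ := cos_sq_add_mul_sin_sq_pos (pow_pos hz 2) (θ x)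
  refine HasDerivAt.congr_deriv
    (_root_.hasDerivAt_scaledAngle (h.hasDerivAt x hx) (hasDerivAt_const x z) hz) ?_
  rw [(sin_scaledAngle hz (θ x)).1, div_pow, Real.sq_sqrt hρ.le]
  field_simp
  ring

lemma le_scaledAngle {z : ℝ} (hz : 0 < z) (hQ : ∀ x, Q x ≤ 0) (h : IsPruferAngle Q (z ^ 2) θ) :
    z ≤ scaledAngle (θ 1) z := by
  have := Convex.mul_sub_le_image_sub_of_le_deriv (convex_Icc (0 : ℝ) 1) (C := z)
    (fun x hx ↦ (h.hasDerivAt_scaledAngle hz hx).continuousAt.continuousWithinAt)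
    (by
      intro x hx
      rw [interior_Icc] at hx
      exact (h.hasDerivAt_scaledAngle hz
        (Ioo_subset_Icc_self hx)).differentiableAt.differentiableWithinAt)
    (by
      intro x hx
      rw [interior_Icc] at hx
      rw [(h.hasDerivAt_scaledAngle hz (Ioo_subset_Icc_self hx)).deriv]
      have := neg_nonneg.2 (hQ x)
      have : 0 ≤ -Q x / z * sin (scaledAngle (θ x) z) ^ 2 := by positivity
      linarith)
    0 (by simp) 1 (by simp) zero_le_one
  rw [h.zero, scaledAngle_zero] at this
  linarith

lemma nonneg (h : IsPruferAngle Q lam θ) : 0 ≤ θ 1 := by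
  have := image_le_of_deriv_right_lt_deriv_boundary (f := fun x ↦ -θ x) (B := fun _ ↦ 0)
    (B' := fun _ ↦ 0) (a := 0) (b := 1)
    h.continuous.neg.continuousOn
    (fun x hx ↦ (h.hasDerivAt x (Ico_subset_Icc_self hx)).neg.hasDerivWithinAt)
    (by simp [h.zero]) (fun x ↦ hasDerivAt_const x 0)
    (by
      intro x _ hx
      have h0 : θ x = 0 := by simpa using hx
      simp [h0])
    (right_mem_Icc.2 zero_le_one)
  simpa using this

lemma le_of_lt {M : ℝ} (hM : ∀ x, |Q x| ≤ M) (h : IsPruferAngle Q (-M - 1) θ) : θ 1 ≤ π / 3 := by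
  refine image_le_of_deriv_right_lt_deriv_boundary (f := θ) (B := fun _ ↦ π / 3)
    (B' := fun _ ↦ 0) (a := 0) (b := 1) h.continuous.continuousOn
    (fun x hx ↦ (h.hasDerivAt x (Ico_subset_Icc_self hx)).hasDerivWithinAt)
    (by rw [h.zero]; positivity) (fun x ↦ hasDerivAt_const x _)
    (by
      intro x _ hx
      rw [hx, Real.cos_pi_div_three, Real.sq_sin_pi_div_three]
      have := neg_abs_le (Q x)
      linarith [hM x])
    (right_mem_Icc.2 zero_le_one)

lemma isDirichletNeumannEigenvalue_iff {q : ℝ → ℝ} (hQ : Continuous Q)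
    (hq : ∀ x ∈ Icc (0 : ℝ) 1, Q x = q x) (h : IsPruferAngle Q lam θ) :
    IsDirichletNeumannEigenvalue q lam ↔ cos (θ 1) = 0 := by
  constructor
  · rintro ⟨y, y', hy, hy', ⟨x, hx, hne⟩, h0, h1⟩
    by_contra hcos
    have hA := h.hasDerivAt_logRadius hQ
    have hv : ∀ x ∈ Icc (0 : ℝ) 1, y x * cos (θ x) - y' x * sin (θ x) = 0 := by
      have hd : ∀ x ∈ Icc (0 : ℝ) 1, HasDerivAt (fun x ↦ (y x * cos (θ x) - y' x * sin (θ x)) *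
          exp (logRadius Q lam θ x)) 0 x := by
        intro x hx
        refine HasDerivAt.congr_deriv ((((hy x hx).mul (h.hasDerivAt x hx).cos).sub
          ((hy' x hx).mul (h.hasDerivAt x hx).sin)).mul (hA x).exp) ?_
        simp only [Pi.sub_apply, Pi.mul_apply]
        rw [← hq x hx]
        linear_combination (-exp (logRadius Q lam θ x) *
          (y' x * cos (θ x) - (Q x - lam) * y x * sin (θ x))) * Real.sin_sq_add_cos_sq (θ x)
      intro x hx
      have := constant_of_has_deriv_right_zero
        (fun x hx ↦ (hd x hx).continuousAt.continuousWithinAt)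
        (fun x hx ↦ (hd x (Ico_subset_Icc_self hx)).hasDerivWithinAt) x hx
      simp only [h0, h.zero, Real.sin_zero, zero_mul, mul_zero, sub_zero] at this
      exact (mul_eq_zero.1 this).resolve_right (Real.exp_pos _).ne'
    have hu1 : y 1 * sin (θ 1) + y' 1 * cos (θ 1) = 0 := by
      have := hv 1 (by simp)
      rw [h1, zero_mul, sub_zero] at this
      rw [h1, (mul_eq_zero.1 this).resolve_right hcos]
      ring
    have hu : ∀ x ∈ Icc (0 : ℝ) 1, y x * sin (θ x) + y' x * cos (θ x) = 0 := by
      have hd : ∀ x ∈ Icc (0 : ℝ) 1, HasDerivAt (fun x ↦ (y x * sin (θ x) + y' x * cos (θ x)) *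
          exp (-logRadius Q lam θ x)) 0 x := by
        intro x hx
        refine HasDerivAt.congr_deriv ((((hy x hx).mul (h.hasDerivAt x hx).sin).add
          ((hy' x hx).mul (h.hasDerivAt x hx).cos)).mul (hA x).neg.exp) ?_
        simp only [Pi.add_apply, Pi.mul_apply, Pi.neg_apply]
        rw [← hq x hx]
        linear_combination (-exp (-logRadius Q lam θ x) *
          (y' x * sin (θ x) + (Q x - lam) * y x * cos (θ x))) * Real.sin_sq_add_cos_sq (θ x) +
          exp (-logRadius Q lam θ x) * (1 + Q x - lam) * (cos (θ x) ^ 2 - sin (θ x) ^ 2) * hv x hx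
      have hconst := constant_of_has_deriv_right_zero
        (fun x hx ↦ (hd x hx).continuousAt.continuousWithinAt)
        (fun x hx ↦ (hd x (Ico_subset_Icc_self hx)).hasDerivWithinAt)
      intro x hx
      have := (hconst x hx).trans (hconst 1 (by simp)).symm
      rw [hu1, zero_mul] at this
      exact (mul_eq_zero.1 this).resolve_right (Real.exp_pos _).ne'
    apply hne
    linear_combination sin (θ x) * hu x hx + cos (θ x) * hv x hx
      - y x * Real.sin_sq_add_cos_sq (θ x)
  · intro hcos
    refine ⟨pruferSol Q lam θ, pruferSol' Q lam θ, fun x hx ↦ h.hasDerivAt_pruferSol hQ hx,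
      fun x hx ↦ ?_, ⟨1, by simp, ?_⟩, ?_, ?_⟩
    · rw [← hq x hx]
      exact h.hasDerivAt_pruferSol' hQ hx
    · refine mul_ne_zero (Real.exp_pos _).ne' fun hs ↦ ?_
      have := Real.sin_sq_add_cos_sq (θ 1)
      simp [hs, hcos] at this
    · simp [pruferSol, h.zero]
    · simp [pruferSol', hcos]

lemma integral_pruferSol_sq_pos (hQ : Continuous Q) (h : IsPruferAngle Q lam θ) :
    0 < ∫ x in (0 : ℝ)..1, pruferSol Q lam θ x ^ 2 := by
  refine intervalIntegral.integral_pos one_pos ((h.continuous_pruferSol hQ).pow 2).continuousOn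
    (fun x _ ↦ sq_nonneg _) ?_
  by_contra! hall
  have hzero : ∀ x ∈ Icc (0 : ℝ) 1, pruferSol Q lam θ x = 0 := fun x hx ↦
    pow_eq_zero_iff two_ne_zero |>.1 (le_antisymm (hall x hx) (sq_nonneg _))
  have hmem : (1 / 2 : ℝ) ∈ Icc (0 : ℝ) 1 := by norm_num
  have hn : Icc (0 : ℝ) 1 ∈ 𝓝 (1 / 2 : ℝ) := Icc_mem_nhds (by norm_num) (by norm_num)
  have h1 : HasDerivAt (pruferSol Q lam θ) 0 (1 / 2) :=
    (hasDerivAt_const (1 / 2 : ℝ) (0 : ℝ)).congr_of_eventuallyEq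
      (by filter_upwards [hn] with x hx using hzero x hx)
  have h2 := (h.hasDerivAt_pruferSol hQ hmem).unique h1
  have hs := (mul_eq_zero.1 (hzero _ hmem)).resolve_left (Real.exp_pos _).ne'
  have hc := (mul_eq_zero.1 h2).resolve_left (Real.exp_pos _).ne'
  have := Real.sin_sq_add_cos_sq (θ (1 / 2))
  rw [hs, hc] at this
  norm_num at this

end IsPruferAngle

/-- If `Q` is nonpositive, increasing and not identically zero on `(0, 1]`, and `-Q ≤ z ^ 2`, then
the scaled Prüfer angle `S` at `1` satisfies
`2 z ^ 2 * ∫ Y ^ 2 + Y Y' < z S (Y ^ 2 + Y' ^ 2 / z ^ 2)`. -/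
lemma IsPruferAngle.integral_add_lt {Q : ℝ → ℝ} {z : ℝ} {θ : ℝ → ℝ} (hQ : Continuous Q)
    (hQ_mono : MonotoneOn Q (Icc 0 1)) (hQ0 : ∀ x, Q x ≤ 0) (hz : 0 < z)
    (hQz : ∀ x ∈ Icc (0 : ℝ) 1, -Q x ≤ z ^ 2) {x₁ : ℝ} (hx₁ : x₁ ∈ Ioc (0 : ℝ) 1)
    (hQx₁ : Q x₁ < 0) (h : IsPruferAngle Q (z ^ 2) θ) :
    2 * z ^ 2 * (∫ x in (0 : ℝ)..1, pruferSol Q (z ^ 2) θ x ^ 2) +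
      pruferSol Q (z ^ 2) θ 1 * pruferSol' Q (z ^ 2) θ 1 <
    z * scaledAngle (θ 1) z *
      (pruferSol Q (z ^ 2) θ 1 ^ 2 + pruferSol' Q (z ^ 2) θ 1 ^ 2 / z ^ 2) := by
  have hρ := fun x ↦ cos_sq_add_mul_sin_sq_pos (pow_pos hz 2) (θ x)
  have hsqrt := fun x ↦ Real.sqrt_pos.2 (hρ x)
  have hYc := (h.continuous_pruferSol hQ).pow 2
  have key := defect_pos (p := fun x ↦ -Q x) (Y := pruferSol Q (z ^ 2) θ)
    (Y' := pruferSol' Q (z ^ 2) θ)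
    (r := fun x ↦ exp (logRadius Q (z ^ 2) θ x) *
      √(cos (θ x) ^ 2 + z ^ 2 * sin (θ x) ^ 2) / z)
    (θ := fun x ↦ scaledAngle (θ x) z)
    (T := fun x ↦ z * scaledAngle (θ x) z *
      (pruferSol Q (z ^ 2) θ x ^ 2 + pruferSol' Q (z ^ 2) θ x ^ 2 / z ^ 2) -
      2 * z ^ 2 * (∫ t in (0 : ℝ)..x, pruferSol Q (z ^ 2) θ t ^ 2) -
      pruferSol Q (z ^ 2) θ x * pruferSol' Q (z ^ 2) θ x)
    hz hQ_mono.neg (fun x _ ↦ neg_nonneg.2 (hQ0 x)) hQz hx₁ (neg_pos.2 hQx₁)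
    (fun x hx ↦ h.hasDerivAt_pruferSol hQ hx)
    (fun x hx ↦ (h.hasDerivAt_pruferSol' hQ hx).congr_deriv (by ring))
    (fun x _ ↦ div_pos (mul_pos (Real.exp_pos _) (hsqrt x)) hz)
    (fun x _ ↦ by
      have := hsqrt x
      rw [(sin_scaledAngle hz _).1, pruferSol]
      field_simp)
    (fun x _ ↦ by
      have := hsqrt x
      rw [(sin_scaledAngle hz _).2, pruferSol']
      field_simp)
    (by simp [h.zero, scaledAngle_zero])
    (fun x hx ↦ h.hasDerivAt_scaledAngle hz hx)
    (by simp [h.zero, scaledAngle_zero, pruferSol])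
    (fun x hx ↦ by
      have hY := h.hasDerivAt_pruferSol hQ hx
      have hY' := h.hasDerivAt_pruferSol' hQ hx
      have hS := h.hasDerivAt_scaledAngle hz hx
      have hI : HasDerivAt (fun x ↦ ∫ t in (0 : ℝ)..x, pruferSol Q (z ^ 2) θ t ^ 2)
          (pruferSol Q (z ^ 2) θ x ^ 2) x :=
        intervalIntegral.integral_hasDerivAt_right (hYc.intervalIntegrable _ _)
          (hYc.stronglyMeasurableAtFilter _ _) hYc.continuousAt
      have hsin : sin (scaledAngle (θ x) z) ^ 2 *
          (pruferSol Q (z ^ 2) θ x ^ 2 + pruferSol' Q (z ^ 2) θ x ^ 2 / z ^ 2) =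
          pruferSol Q (z ^ 2) θ x ^ 2 := by
        have := hρ x
        rw [(sin_scaledAngle hz _).1, div_pow, Real.sq_sqrt this.le, pruferSol, pruferSol']
        field_simp
        ring
      refine HasDerivAt.congr_deriv ((((hS.const_mul z).mul
        ((hY.pow 2).add ((hY'.pow 2).div_const (z ^ 2)))).sub (hI.const_mul (2 * z ^ 2))).sub
        (hY.mul hY')) ?_
      simp only [Pi.add_apply, Pi.pow_apply]
      have hzz : z * z⁻¹ = 1 := mul_inv_cancel₀ hz.ne'
      rw [mul_add z z, show z * (-Q x / z * sin (scaledAngle (θ x) z) ^ 2) =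
        -Q x * sin (scaledAngle (θ x) z) ^ 2 by field_simp, add_mul (z * z),
        mul_assoc (-Q x), hsin]
      field_simp
      push_cast
      ring)
  linarith

/-- Under the assumptions of `IsPruferAngle.integral_add_lt` the ratio of the scaled Prüfer angle
to `z` has negative derivative. -/
lemma hasDerivAt_scaledAngle_div {Q : ℝ → ℝ} {M z : ℝ} {θ : ℝ → ℝ → ℝ} (hQ : Continuous Q)
    (hM : ∀ x, |Q x| ≤ M) (hQ_mono : MonotoneOn Q (Icc 0 1)) (hQ0 : ∀ x, Q x ≤ 0) (hz : 0 < z)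
    (hQz : ∀ x ∈ Icc (0 : ℝ) 1, -Q x ≤ z ^ 2) {x₁ : ℝ} (hx₁ : x₁ ∈ Ioc (0 : ℝ) 1)
    (hQx₁ : Q x₁ < 0) (hθ : ∀ lam, IsPruferAngle Q lam (θ lam)) :
    ∃ d < 0, HasDerivAt (fun z ↦ scaledAngle (θ (z ^ 2) 1) z / z) d z := by
  have hlt := (hθ (z ^ 2)).integral_add_lt hQ hQ_mono hQ0 hz hQz hx₁ hQx₁
  have hΘ : HasDerivAt (fun z ↦ θ (z ^ 2) 1)
      ((∫ x in (0 : ℝ)..1, pruferSol Q (z ^ 2) (θ (z ^ 2)) x ^ 2) /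
        exp (logRadius Q (z ^ 2) (θ (z ^ 2)) 1) ^ 2 * (2 * z)) z :=
    ((hasDerivAt_pruferAngle_one hQ hM hθ (z ^ 2)).comp (h₂ := fun lam ↦ θ lam 1) z
      (hasDerivAt_pow 2 z)).congr_deriv (by norm_num)
  refine ⟨_, ?_, (hasDerivAt_scaledAngle hΘ (hasDerivAt_id z) hz).div (hasDerivAt_id z) hz.ne'⟩
  have hρ := cos_sq_add_mul_sin_sq_pos (pow_pos hz 2) (θ (z ^ 2) 1)
  have hE := Real.exp_pos (logRadius Q (z ^ 2) (θ (z ^ 2)) 1)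
  unfold pruferSol' at hlt
  generalize hI : ∫ x in (0 : ℝ)..1, pruferSol Q (z ^ 2) (θ (z ^ 2)) x ^ 2 = I at *
  unfold pruferSol at hlt
  simp only [id] at *
  generalize exp (logRadius Q (z ^ 2) (θ (z ^ 2)) 1) = E at *
  generalize scaledAngle (θ (z ^ 2) 1) z = S at *
  generalize sin (θ (z ^ 2) 1) = s at *
  generalize cos (θ (z ^ 2) 1) = c at *
  refine div_neg_of_neg_of_pos ?_ (by positivity)
  rw [mul_one, div_mul_eq_mul_div, sub_neg, div_lt_iff₀ hρ]
  have e1 : z * S * ((E * s) ^ 2 + (E * c) ^ 2 / z ^ 2) =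
      E ^ 2 / z * (S * (c ^ 2 + z ^ 2 * s ^ 2)) := by
    field_simp
    ring
  have e2 : 2 * z ^ 2 * I + E * s * (E * c) =
      E ^ 2 / z * ((z * (I / E ^ 2 * (2 * z)) + 1 * (s * c)) * z) := by
    field_simp
  rw [e1, e2] at hlt
  exact lt_of_mul_lt_mul_left hlt (by positivity)

/-- The `k`-th eigenvalue is the parameter at which the Prüfer angle at `1` equals
`(k - 1 / 2) * π`. -/
lemma pruferAngle_one_eq {q Q : ℝ → ℝ} {M : ℝ} {θ : ℝ → ℝ → ℝ} (hQ : Continuous Q)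
    (hM : ∀ x, |Q x| ≤ M) (hq : ∀ x ∈ Icc (0 : ℝ) 1, Q x = q x) (hQ0 : ∀ x, Q x ≤ 0)
    (hθ : ∀ lam, IsPruferAngle Q lam (θ lam)) {μ : ℕ+ → ℝ} (hμ_mono : StrictMono μ)
    (hμ_eig : ∀ n : ℕ+, IsDirichletNeumannEigenvalue q (μ n))
    (hμ_all : ∀ lam : ℝ, IsDirichletNeumannEigenvalue q lam → ∃ n : ℕ+, μ n = lam) (k : ℕ+) :
    θ (μ k) 1 = ((k : ℝ) - 1 / 2) * π := by
  have hpi := Real.pi_pos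
  have hd := hasDerivAt_pruferAngle_one hQ hM hθ
  have hmono : StrictMono fun lam ↦ θ lam 1 :=
    strictMono_of_hasDerivAt_pos hd fun lam ↦
      div_pos ((hθ lam).integral_pruferSol_sq_pos hQ) (by positivity)
  have hcont : Continuous fun lam ↦ θ lam 1 :=
    continuous_iff_continuousAt.2 fun lam ↦ (hd lam).continuousAt
  have hex : ∀ k : ℕ+, ∃ lam, θ lam 1 = ((k : ℝ) - 1 / 2) * π := by
    intro k
    have hk : (1 : ℝ) ≤ k := by exact_mod_cast k.2
    have hlow := (hθ (-M - 1)).le_of_lt hM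
    have hz : 0 < (k : ℝ) * π := by positivity
    have hup := ((hθ (((k : ℝ) * π) ^ 2)).le_scaledAngle hz hQ0).trans (scaledAngle_le _ _)
    have hM0 : 0 ≤ M := (abs_nonneg _).trans (hM 0)
    obtain ⟨lam, -, hlam⟩ := intermediate_value_Icc
      (show -M - 1 ≤ ((k : ℝ) * π) ^ 2 by nlinarith [sq_nonneg ((k : ℝ) * π)])
      hcont.continuousOn (show ((k : ℝ) - 1 / 2) * π ∈ _ from ⟨by nlinarith, by linarith⟩)
    exact ⟨lam, hlam⟩
  choose ν hν using hex
  have hν_mono : StrictMono ν := by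
    intro j k hjk
    rw [← hmono.lt_iff_lt]
    simp only [hν]
    have : (j : ℝ) < k := by exact_mod_cast hjk
    nlinarith
  have hrange : range μ = range ν := by
    ext lam
    have hiff := (hθ lam).isDirichletNeumannEigenvalue_iff hQ hq
    constructor
    · rintro ⟨n, rfl⟩
      obtain ⟨j, hj⟩ := Real.cos_eq_zero_iff.1 (hiff.1 (hμ_eig n))
      have h0 := (hθ (μ n)).nonneg
      have hj0 : 0 ≤ j := by
        by_contra! hneg
        have : (j : ℝ) ≤ -1 := by exact_mod_cast Int.le_sub_one_of_lt hneg
        nlinarith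
      lift j to ℕ using hj0
      refine ⟨j.succPNat, hmono.injective ?_⟩
      simp only [hν, hj, Nat.succPNat_coe]
      push_cast
      ring
    · rintro ⟨k, rfl⟩
      refine hμ_all _ (hiff.2 (Real.cos_eq_zero_iff.2 ⟨(k : ℤ) - 1, ?_⟩))
      rw [hν]
      push_cast
      ring
  rw [(hμ_mono.range_inj hν_mono).1 hrange, hν]

end

/-!
**Statement 7.**  Let `q : [0,1] → ℝ` be continuous, nonpositive and increasing on
`[0,1]`, and set `q₋ = min {q x : x ∈ [0,1]}`.  Let `λ₁ < λ₂ < ⋯` enumerate the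
eigenvalues of the Dirichlet–Neumann problem `−y'' + q y = λ y` on `[0,1]`,
`y 0 = y' 1 = 0`.  If for two different indices `n ≠ m` with `λ_n > λ_m ≥ −2 q₋` the
equality `λ_n / λ_m = (2n−1)² / (2m−1)²` holds, then `q ≡ 0` on `(0,1]`.
-/
theorem dirichlet_neumann_eigenvalue_ratio_equality_implies_q_zero
    (q : ℝ → ℝ)
    (hq_cont : ContinuousOn q (Set.Icc 0 1))
    (hq_nonpos : ∀ x ∈ Set.Icc (0 : ℝ) 1, q x ≤ 0)
    (hq_inc : MonotoneOn q (Set.Icc 0 1))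
    (qmin : ℝ) (hqmin : IsLeast (q '' Set.Icc 0 1) qmin)
    -- `μ n` is the `n`-th Dirichlet–Neumann eigenvalue: `μ` is the strictly
    -- increasing enumeration of the whole spectrum
    (μ : ℕ+ → ℝ) (hμ_mono : StrictMono μ)
    (hμ_eig : ∀ n : ℕ+, IsDirichletNeumannEigenvalue q (μ n))
    (hμ_all : ∀ lam : ℝ, IsDirichletNeumannEigenvalue q lam → ∃ n : ℕ+, μ n = lam)
    (heq : ∃ n m : ℕ+, n ≠ m ∧ μ m < μ n ∧ -2 * qmin ≤ μ m ∧
      μ n / μ m = (2 * (n : ℝ) - 1) ^ 2 / (2 * (m : ℝ) - 1) ^ 2) :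
    ∀ x ∈ Set.Ioc (0 : ℝ) 1, q x = 0 := by
  by_contra! hne
  obtain ⟨x₁, hx₁, hqx₁⟩ := hne
  obtain ⟨n, m, -, hlt, hmin, hratio⟩ := heq
  obtain ⟨⟨x₀, hx₀, rfl⟩, hleast⟩ := hqmin
  have hle : ∀ x ∈ Set.Icc (0 : ℝ) 1, q x₀ ≤ q x := fun x hx ↦ hleast ⟨x, hx, rfl⟩
  have hneg : q x₁ < 0 := lt_of_le_of_ne (hq_nonpos x₁ (Set.Ioc_subset_Icc_self hx₁)) hqx₁
  have hneg₀ : q x₀ < 0 := (hle x₁ (Set.Ioc_subset_Icc_self hx₁)).trans_lt hneg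
  set Q : ℝ → ℝ := Set.IccExtend zero_le_one ((Set.Icc (0 : ℝ) 1).domRestrict q) with hQdef
  have hQq : ∀ x ∈ Set.Icc (0 : ℝ) 1, Q x = q x := fun x hx ↦ by
    simp [hQdef, Set.IccExtend_of_mem zero_le_one _ hx]
  have hQmem : ∀ x, ∃ t ∈ Set.Icc (0 : ℝ) 1, Q x = q t := fun x ↦
    ⟨Set.projIcc 0 1 zero_le_one x, (Set.projIcc 0 1 zero_le_one x).2, rfl⟩
  have hQ : Continuous Q := (continuousOn_iff_continuous_domRestrict.1 hq_cont).Icc_extend'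
  have hQ0 : ∀ x, Q x ≤ 0 := fun x ↦ by
    obtain ⟨t, ht, hx⟩ := hQmem x
    exact hx.trans_le (hq_nonpos t ht)
  have hQmin : ∀ x, q x₀ ≤ Q x := fun x ↦ by
    obtain ⟨t, ht, hx⟩ := hQmem x
    exact (hle t ht).trans_eq hx.symm
  have hM : ∀ x, |Q x| ≤ -q x₀ := fun x ↦ by
    rw [abs_of_nonpos (hQ0 x)]
    linarith [hQmin x]
  have hQ_mono : MonotoneOn Q (Set.Icc 0 1) := fun x hx y hy hxy ↦ by
    rw [hQq x hx, hQq y hy]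
    exact hq_inc hx hy hxy
  choose θ hθ using exists_isPruferAngle hQ hM
  have hΘ := pruferAngle_one_eq hQ hM hQq hQ0 hθ hμ_mono hμ_eig hμ_all
  have hm : 0 < μ m := by linarith
  have hn : 0 < μ n := hm.trans hlt
  have hsm := Real.sqrt_pos.2 hm
  have hsn := Real.sqrt_pos.2 hn
  have hslt := Real.sqrt_lt_sqrt hm.le hlt
  have hder : ∀ z ∈ Set.Icc √(μ m) √(μ n),
      ∃ d < 0, HasDerivAt (fun z ↦ scaledAngle (θ (z ^ 2) 1) z / z) d z := by
    intro z hz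
    have hμz : μ m ≤ z ^ 2 := by
      rw [← Real.sq_sqrt hm.le]
      exact pow_le_pow_left₀ hsm.le hz.1 2
    refine hasDerivAt_scaledAngle_div hQ hM hQ_mono hQ0 (hsm.trans_le hz.1) (fun x _ ↦ ?_) hx₁
      ((hQq x₁ (Set.Ioc_subset_Icc_self hx₁)).trans_lt hneg) hθ
    linarith [hQmin x]
  have hanti : StrictAntiOn (fun z ↦ scaledAngle (θ (z ^ 2) 1) z / z) (Set.Icc √(μ m) √(μ n)) := by
    refine strictAntiOn_of_deriv_neg (convex_Icc _ _) (fun z hz ↦ ?_) (fun z hz ↦ ?_)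
    · obtain ⟨d, -, hd⟩ := hder z hz
      exact hd.continuousAt.continuousWithinAt
    · obtain ⟨d, hd0, hd⟩ := hder z (interior_subset hz)
      rwa [hd.deriv]
  have hval : ∀ k, 0 < μ k → scaledAngle (θ (√(μ k) ^ 2) 1) √(μ k) = ((k : ℝ) - 1 / 2) * Real.pi := by
    intro k hk
    rw [Real.sq_sqrt hk.le, scaledAngle_of_cos_eq_zero, hΘ]
    exact ((hθ (μ k)).isDirichletNeumannEigenvalue_iff hQ hQq).1 (hμ_eig k)
  have hcontra := hanti (Set.left_mem_Icc.2 hslt.le) (Set.right_mem_Icc.2 hslt.le) hslt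
  simp only [hval _ hm, hval _ hn] at hcontra
  have hm1 : (1 : ℝ) ≤ m := by exact_mod_cast m.2
  have hn1 : (1 : ℝ) ≤ n := by exact_mod_cast n.2
  have hroot : √(μ n) / √(μ m) = (2 * (n : ℝ) - 1) / (2 * (m : ℝ) - 1) := by
    rw [← Real.sqrt_div hn.le, hratio, ← div_pow,
      Real.sqrt_sq (div_nonneg (by linarith) (by linarith))]
  rw [div_eq_div_iff hsm.ne' (by linarith)] at hroot
  rw [div_lt_div_iff₀ hsn hsm] at hcontra
  refine hcontra.ne ?_
  linear_combination (-Real.pi / 2) * hroot
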